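/- arXiv:1510.09102 — 2 statements merged into one kernel-verified Lean document; each statement's English description precedes it below -/
import Mathlib

section
/- Let D = ⟨Q, μ0, L, δ⟩ be a labelled MDP. Define an increasing sequence of subspaces of ℝ^Q (as column-vector spaces): V_0 = span{1} (the all-ones vector), and V_{n+1} is the smallest vector space containing V_n and containing Δ_{α̂}(a)·u for all u ∈ V_n, all a ∈ L, and all local strategies α̂ that are extremal with respect to V_n (i.e., with respect to any matrix whose columns span V_n). Let V = V_s where s is the smallest index with V_s = V_{s+1}; then s ≤ |Q|−1, and for all subdistributions μ_D, μ_E over Q: μ_D ∼ μ_E if and only if μ_D·u = μ_E·u for all u ∈ V. -/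
open Matrix

/-- A labelled Markov decision process (data part): an initial distribution,
a finite nonempty set of available moves at each state, and for each move a
probability distribution on `L × Q`. -/
structure PreMDP (Q L M : Type*) where
  init : Q → ℝ
  moves : Q → Finset M
  prob : M → L → Q → ℝ

/-- The well-formedness conditions making a `PreMDP` a labelled MDP. -/
def IsMDP {Q L M : Type*} [Fintype Q] [Fintype L] (D : PreMDP Q L M) : Prop :=
  (∀ q, 0 ≤ D.init q) ∧ (∑ q, D.init q = 1) ∧
  (∀ q, (D.moves q).Nonempty) ∧
  (∀ m a q', 0 ≤ D.prob m a q') ∧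
  (∀ q, ∀ m ∈ D.moves q, ∑ a : L, ∑ q' : Q, D.prob m a q' = 1)

/-- A path `q0 a1 q1 ⋯ an qn`: the initial state together with the list of
(label, state) steps. -/
abbrev MPath (Q L : Type*) := Q × List (L × Q)

/-- The last state of a path. -/
def MPath.last {Q L : Type*} (ρ : MPath Q L) : Q :=
  (ρ.2.getLast?).elim ρ.1 Prod.snd

/-- The trace of a path. -/
def MPath.trace {Q L : Type*} (ρ : MPath Q L) : List L := ρ.2.map Prod.fst

/-- A strategy: to each path a probability distribution on the moves available
at its last state. -/
def IsStrategy {Q L M : Type*} (D : PreMDP Q L M) (α : MPath Q L → M → ℝ) : Prop :=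
  ∀ ρ : MPath Q L, (∀ m, 0 ≤ α ρ m) ∧ (∀ m, m ∉ D.moves (MPath.last ρ) → α ρ m = 0) ∧
    (∑ m ∈ D.moves (MPath.last ρ), α ρ m = 1)

/-- A strategy is trace-based if it depends only on the trace and the last
state of the path. -/
def TraceBased {Q L M : Type*} (α : MPath Q L → M → ℝ) : Prop :=
  ∀ ρ ρ' : MPath Q L, MPath.trace ρ = MPath.trace ρ' → MPath.last ρ = MPath.last ρ' → α ρ = α ρ'

/-- Probability of performing the given further steps, starting from the path `ρ`. -/
def probFrom {Q L M : Type*} (D : PreMDP Q L M) (α : MPath Q L → M → ℝ) :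
    MPath Q L → List (L × Q) → ℝ
  | _, [] => 1
  | ρ, (a, q) :: rest =>
      (∑ m ∈ D.moves (MPath.last ρ), α ρ m * D.prob m a q) *
        probFrom D α (ρ.1, ρ.2 ++ [(a, q)]) rest

/-- The probability `Pr_{D,α}(ρ)` of a path. -/
def pathProb {Q L M : Type*} (D : PreMDP Q L M) (α : MPath Q L → M → ℝ) (ρ : MPath Q L) : ℝ :=
  D.init ρ.1 * probFrom D α (ρ.1, []) ρ.2

/-- `subDis D α w q` : the total probability of paths with trace `w` ending in `q`. -/
def subDis {Q L M : Type*} [Fintype Q] [DecidableEq Q] (D : PreMDP Q L M)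
    (α : MPath Q L → M → ℝ) (w : List L) (q : Q) : ℝ :=
  ∑ q0 : Q, ∑ f : Fin w.length → Q,
    if MPath.last ((q0, List.ofFn fun i => (w.get i, f i)) : MPath Q L) = q then
      pathProb D α (q0, List.ofFn fun i => (w.get i, f i)) else 0

/-- The trace-probability function `Tr_{D,α}`. -/
def Tr {Q L M : Type*} [Fintype Q] [DecidableEq Q] (D : PreMDP Q L M)
    (α : MPath Q L → M → ℝ) (w : List L) : ℝ :=
  ∑ q : Q, subDis D α w q

/-- A local strategy: to each state a probability distribution on the moves
available there. -/
def IsLocal {Q L M : Type*} (D : PreMDP Q L M) (β : Q → M → ℝ) : Prop :=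
  ∀ q, (∀ m, 0 ≤ β q m) ∧ (∀ m, m ∉ D.moves q → β q m = 0) ∧ (∑ m ∈ D.moves q, β q m = 1)

/-- The transition matrix `Δ_β(a)` of a local strategy `β` and label `a`. -/
def transMat {Q L M : Type*} (D : PreMDP Q L M) (β : Q → M → ℝ) (a : L) : Matrix Q Q ℝ :=
  Matrix.of fun q q' => ∑ m ∈ D.moves q, β q m * D.prob m a q'

/-- `Succ(μ, β, a) = μ · Δ_β(a)`. -/
def Succ {Q L M : Type*} [Fintype Q] (D : PreMDP Q L M) (μ : Q → ℝ) (β : Q → M → ℝ)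
    (a : L) : Q → ℝ :=
  Matrix.vecMul μ (transMat D β a)

/-- Subdistributions over `Q` (viewed as row vectors). -/
def IsSubDist {Q : Type*} [Fintype Q] (μ : Q → ℝ) : Prop :=
  (∀ q, 0 ≤ μ q) ∧ (∑ q, μ q) ≤ 1

/-- A bisimulation between (sub)distributions of two MDPs. -/
def IsBisim {Q Q' L M M' : Type*} [Fintype Q] [Fintype Q'] (D : PreMDP Q L M)
    (E : PreMDP Q' L M') (R : (Q → ℝ) → (Q' → ℝ) → Prop) : Prop :=
  ∀ μ ν, R μ ν →
    ((∑ q, μ q) = (∑ q, ν q)) ∧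
    (∀ β, IsLocal D β → ∃ γ, IsLocal E γ ∧ ∀ a, R (Succ D μ β a) (Succ E ν γ a)) ∧
    (∀ γ, IsLocal E γ → ∃ β, IsLocal D β ∧ ∀ a, R (Succ D μ β a) (Succ E ν γ a))

/-- `μ ∼ ν`: the largest bisimulation (union of all bisimulations). -/
def Bisim {Q Q' L M M' : Type*} [Fintype Q] [Fintype Q'] (D : PreMDP Q L M)
    (E : PreMDP Q' L M') (μ : Q → ℝ) (ν : Q' → ℝ) : Prop :=
  ∃ R, IsBisim D E R ∧ R μ ν

/-- The approximants `∼ₙ` of the bisimulation relation. -/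
def simN {Q L M : Type*} [Fintype Q] (D : PreMDP Q L M) : ℕ → (Q → ℝ) → (Q → ℝ) → Prop
  | 0 => fun μ ν => (∑ q, μ q) = (∑ q, ν q)
  | n + 1 => fun μ ν =>
      ((∑ q, μ q) = (∑ q, ν q)) ∧
      (∀ β, IsLocal D β → ∃ γ, IsLocal D γ ∧ ∀ a, simN D n (Succ D μ β a) (Succ D ν γ a)) ∧
      (∀ γ, IsLocal D γ → ∃ β, IsLocal D β ∧ ∀ a, simN D n (Succ D μ β a) (Succ D ν γ a))

/-- The point `p(μ, β) ∈ ℝ^{L × k}`: the concatenation of the row vectors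
`μ · Δ_β(a) · B` for `a ∈ L`. -/
def point {Q L M : Type*} {k : ℕ} [Fintype Q] (D : PreMDP Q L M) (B : Matrix Q (Fin k) ℝ)
    (μ : Q → ℝ) (β : Q → M → ℝ) : L × Fin k → ℝ :=
  fun x => Matrix.vecMul (Matrix.vecMul μ (transMat D β x.1)) B x.2

/-- `β̂` is extremal in direction `v` with respect to `B`. -/
def ExtremalIn {Q L M : Type*} {k : ℕ} [Fintype Q] [Fintype L] [Fintype M] [DecidableEq Q]
    (D : PreMDP Q L M) (B : Matrix Q (Fin k) ℝ) (βh : Q → M → ℝ) (v : L × Fin k → ℝ) : Prop :=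
  ∀ q : Q, ∀ β, IsLocal D β →
    point D B (Pi.single q 1) β ⬝ᵥ v ≤ point D B (Pi.single q 1) βh ⬝ᵥ v ∧
    (point D B (Pi.single q 1) β ⬝ᵥ v = point D B (Pi.single q 1) βh ⬝ᵥ v →
      point D B (Pi.single q 1) β = point D B (Pi.single q 1) βh)

/-- `β̂` is extremal with respect to `B`: extremal in some direction. -/
def Extremal {Q L M : Type*} {k : ℕ} [Fintype Q] [Fintype L] [Fintype M] [DecidableEq Q]
    (D : PreMDP Q L M) (B : Matrix Q (Fin k) ℝ) (βh : Q → M → ℝ) : Prop :=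
  ∃ v, ExtremalIn D B βh v

/-- The polytope `P_μ = { p(μ, β) : β a local strategy }`. -/
def Pset {Q L M : Type*} {k : ℕ} [Fintype Q] (D : PreMDP Q L M) (B : Matrix Q (Fin k) ℝ)
    (μ : Q → ℝ) : Set (L × Fin k → ℝ) :=
  { x | ∃ β, IsLocal D β ∧ x = point D B μ β }

/-- Column space of a matrix. -/
def colSpace {Q : Type*} {k : ℕ} (B : Matrix Q (Fin k) ℝ) : Submodule ℝ (Q → ℝ) :=
  Submodule.span ℝ (Set.range fun j => fun q => B q j)

/-- `β̂` is extremal with respect to a subspace `V` of `ℝ^Q`: extremal with respect to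
some matrix whose columns span `V`. -/
def ExtremalSpace {Q L M : Type*} [Fintype Q] [Fintype L] [Fintype M] [DecidableEq Q]
    (D : PreMDP Q L M) (V : Submodule ℝ (Q → ℝ)) (βh : Q → M → ℝ) : Prop :=
  ∃ (k : ℕ) (B : Matrix Q (Fin k) ℝ), colSpace B = V ∧ Extremal D B βh

/-- The increasing sequence of subspaces `V_0 = span{1}`,
`V_{n+1} = V_n + span{Δ_{α̂}(a)·u : u ∈ V_n, a ∈ L, α̂ extremal w.r.t. V_n}`. -/
def Vseq {Q L M : Type*} [Fintype Q] [Fintype L] [Fintype M] [DecidableEq Q]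
    (D : PreMDP Q L M) : ℕ → Submodule ℝ (Q → ℝ)
  | 0 => Submodule.span ℝ {fun _ => (1 : ℝ)}
  | n + 1 => Vseq D n ⊔ Submodule.span ℝ
      { x | ∃ u ∈ Vseq D n, ∃ a : L, ∃ βh : Q → M → ℝ, IsLocal D βh ∧
          ExtremalSpace D (Vseq D n) βh ∧ x = Matrix.mulVec (transMat D βh a) u }

section Points

variable {Q L M : Type*} {k : ℕ} [Fintype Q] (D : PreMDP Q L M) (B : Matrix Q (Fin k) ℝ)

/-- The contribution of a single move to the points `point D B μ β`. -/
def moveVec (m : M) : L × Fin k → ℝ :=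
  fun x => ∑ q', D.prob m x.1 q' * B q' x.2

theorem point_eq_sum (μ : Q → ℝ) (β : Q → M → ℝ) :
    point D B μ β = ∑ q, μ q • ∑ m ∈ D.moves q, β q m • moveVec D B m := by
  ext x
  rw [point, Matrix.vecMul_vecMul]
  simp only [Matrix.vecMul, dotProduct, Matrix.mul_apply, transMat, Matrix.of_apply,
    Finset.sum_apply, Pi.smul_apply, smul_eq_mul, moveVec]
  refine Finset.sum_congr rfl fun q _ => ?_
  congr 1
  simp only [Finset.sum_mul, Finset.mul_sum]
  rw [Finset.sum_comm]
  simp only [mul_assoc]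

theorem point_single [DecidableEq Q] (q : Q) (β : Q → M → ℝ) :
    point D B (Pi.single q 1) β = ∑ m ∈ D.moves q, β q m • moveVec D B m := by
  rw [point_eq_sum, Finset.sum_eq_single q]
  · simp
  · intro q' _ h
    simp [h]
  · simp

theorem point_eq_sum_single [DecidableEq Q] (μ : Q → ℝ) (β : Q → M → ℝ) :
    point D B μ β = ∑ q, μ q • point D B (Pi.single q 1) β := by
  simp only [point_single]
  exact point_eq_sum D B μ β

theorem point_dotProduct [DecidableEq Q] [Fintype L] (μ : Q → ℝ) (β : Q → M → ℝ)
    (v : L × Fin k → ℝ) :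
    point D B μ β ⬝ᵥ v = ∑ q, μ q * (point D B (Pi.single q 1) β ⬝ᵥ v) := by
  rw [point_eq_sum_single, sum_dotProduct]
  simp only [smul_dotProduct, smul_eq_mul]

theorem isLinearMap_point (μ : Q → ℝ) : IsLinearMap ℝ (point D B μ) where
  map_add β γ := by
    simp only [point_eq_sum, Pi.add_apply, add_smul, smul_add, Finset.sum_add_distrib]
  map_smul c β := by
    simp only [point_eq_sum, Pi.smul_apply, Finset.smul_sum, smul_smul, smul_eq_mul]
    refine Finset.sum_congr rfl fun q _ => Finset.sum_congr rfl fun m _ => ?_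
    congr 1
    ring

theorem point_eq_point_iff {μ ν : Q → ℝ} {β γ : Q → M → ℝ} :
    point D B μ β = point D B ν γ ↔
      ∀ a, ∀ u ∈ colSpace B, Succ D μ β a ⬝ᵥ u = Succ D ν γ a ⬝ᵥ u := by
  constructor
  · intro h a u hu
    induction hu using Submodule.span_induction with
    | mem x hx =>
      obtain ⟨j, rfl⟩ := hx
      exact congrFun h (a, j)
    | zero => simp
    | add x y _ _ hx hy => rw [dotProduct_add, dotProduct_add, hx, hy]
    | smul c x _ hx => rw [dotProduct_smul, dotProduct_smul, hx]
  · intro h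
    ext x
    exact h x.1 _ (Submodule.subset_span ⟨x.2, rfl⟩)

end Points

theorem Succ_dotProduct {Q L M : Type*} [Fintype Q] (D : PreMDP Q L M) (μ : Q → ℝ)
    (β : Q → M → ℝ) (a : L) (u : Q → ℝ) :
    Succ D μ β a ⬝ᵥ u = μ ⬝ᵥ (transMat D β a *ᵥ u) :=
  (Matrix.dotProduct_mulVec _ _ _).symm

theorem Succ_nonneg {Q L M : Type*} [Fintype Q] {D : PreMDP Q L M}
    (hD : ∀ m a q, 0 ≤ D.prob m a q) {μ : Q → ℝ} (hμ : 0 ≤ μ) {β : Q → M → ℝ}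
    (hβ : IsLocal D β) (a : L) : 0 ≤ Succ D μ β a := fun q' =>
  Finset.sum_nonneg fun q _ => mul_nonneg (hμ q) <|
    Finset.sum_nonneg fun m _ => mul_nonneg ((hβ q).1 m) (hD m a q')

theorem exists_colSpace_eq {Q : Type*} [Finite Q] (V : Submodule ℝ (Q → ℝ)) :
    ∃ (k : ℕ) (B : Matrix Q (Fin k) ℝ), colSpace B = V := by
  obtain ⟨k, f, hf⟩ := Submodule.fg_iff_exists_fin_generating_family.1
    (IsNoetherian.noetherian V)
  exact ⟨k, Matrix.of fun q j => f j q, hf⟩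

section PureStrategy

variable {Q L M : Type*} {D : PreMDP Q L M} {g : Q → M}

open Classical in
/-- The local strategy choosing the move `g q` at every state `q`. -/
noncomputable def pureStrategy (g : Q → M) : Q → M → ℝ := fun q => Pi.single (g q) 1

theorem isLocal_pureStrategy (hg : ∀ q, g q ∈ D.moves q) :
    IsLocal D (pureStrategy g) := by
  classical
  refine fun q => ⟨fun m => ?_, fun m hm => ?_, ?_⟩
  · by_cases h : m = g q <;> simp [pureStrategy, h]
  · have h : m ≠ g q := fun h => hm (h ▸ hg q)
    simp [pureStrategy, h]
  · simp [pureStrategy, Pi.single_apply, hg q]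

theorem point_single_pureStrategy {k : ℕ} [Fintype Q] [DecidableEq Q] {B : Matrix Q (Fin k) ℝ}
    (hg : ∀ q, g q ∈ D.moves q) (q : Q) :
    point D B (Pi.single q 1) (pureStrategy g) = moveVec D B (g q) := by
  classical
  rw [point_single, Finset.sum_eq_single (g q)]
  · simp [pureStrategy]
  · intro m _ h
    simp [pureStrategy, h]
  · exact fun h => absurd (hg q) h

end PureStrategy

section Extremal

variable {Q L M : Type*} {k : ℕ} [Fintype Q] [Fintype L] [Fintype M] [DecidableEq Q]
  {D : PreMDP Q L M} {B : Matrix Q (Fin k) ℝ} {α : Q → M → ℝ} {v : L × Fin k → ℝ}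

theorem ExtremalIn.dotProduct_le (h : ExtremalIn D B α v) {μ : Q → ℝ} (hμ : 0 ≤ μ)
    {β : Q → M → ℝ} (hβ : IsLocal D β) :
    point D B μ β ⬝ᵥ v ≤ point D B μ α ⬝ᵥ v := by
  rw [point_dotProduct, point_dotProduct D B μ α]
  exact Finset.sum_le_sum fun q _ => mul_le_mul_of_nonneg_left (h q β hβ).1 (hμ q)

theorem ExtremalIn.point_eq (h : ExtremalIn D B α v) {μ : Q → ℝ} (hμ : 0 ≤ μ)
    {β : Q → M → ℝ} (hβ : IsLocal D β) (heq : point D B μ β ⬝ᵥ v = point D B μ α ⬝ᵥ v) :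
    point D B μ β = point D B μ α := by
  rw [point_dotProduct, point_dotProduct D B μ α, Finset.sum_eq_sum_iff_of_le
    fun q _ => mul_le_mul_of_nonneg_left (h q β hβ).1 (hμ q)] at heq
  rw [point_eq_sum_single, point_eq_sum_single D B μ α]
  refine Finset.sum_congr rfl fun q hq => ?_
  rcases eq_or_ne (μ q) 0 with h0 | h0
  · simp [h0]
  · rw [(h q β hβ).2 (mul_left_cancel₀ h0 (heq q hq))]

theorem exists_extremalIn_pureStrategy (hD : ∀ q, (D.moves q).Nonempty)
    (hv : ∀ m m', moveVec D B m ⬝ᵥ v = moveVec D B m' ⬝ᵥ v → moveVec D B m = moveVec D B m') :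
    ∃ g : Q → M, (∀ q, g q ∈ D.moves q) ∧ ExtremalIn D B (pureStrategy g) v := by
  choose g hg hmax using fun q =>
    (D.moves q).exists_max_image (fun m => moveVec D B m ⬝ᵥ v) (hD q)
  refine ⟨g, hg, fun q β hβ => ?_⟩
  rw [point_single_pureStrategy hg, point_single, sum_dotProduct]
  simp only [smul_dotProduct, smul_eq_mul]
  have hle : ∀ m ∈ D.moves q,
      β q m * (moveVec D B m ⬝ᵥ v) ≤ β q m * (moveVec D B (g q) ⬝ᵥ v) :=
    fun m hm => mul_le_mul_of_nonneg_left (hmax q m hm) ((hβ q).1 m)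
  have hsum : ∑ m ∈ D.moves q, β q m * (moveVec D B (g q) ⬝ᵥ v) = moveVec D B (g q) ⬝ᵥ v := by
    rw [← Finset.sum_mul, (hβ q).2.2, one_mul]
  refine ⟨(Finset.sum_le_sum hle).trans_eq hsum, fun heq => ?_⟩
  rw [← hsum, Finset.sum_eq_sum_iff_of_le hle] at heq
  calc ∑ m ∈ D.moves q, β q m • moveVec D B m
      = ∑ m ∈ D.moves q, β q m • moveVec D B (g q) := by
        refine Finset.sum_congr rfl fun m hm => ?_
        rcases eq_or_ne (β q m) 0 with h0 | h0
        · simp [h0]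
        · rw [hv m (g q) (mul_left_cancel₀ h0 (heq m hm))]
    _ = moveVec D B (g q) := by rw [← Finset.sum_smul, (hβ q).2.2, one_smul]

end Extremal

theorem isCompact_setOf_isLocal {Q L M : Type*} (D : PreMDP Q L M) :
    IsCompact {β : Q → M → ℝ | IsLocal D β} := by
  refine (isCompact_Icc (a := (0 : Q → M → ℝ)) (b := 1)).of_isClosed_subset ?_ ?_
  · simp only [IsLocal, Set.ofPred_forall, Set.ofPred_and]
    refine isClosed_iInter fun q => ((isClosed_iInter fun m => ?_).inter
      ((isClosed_iInter fun m => isClosed_iInter fun _ => ?_).inter ?_))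
    · exact isClosed_le (by fun_prop) (by fun_prop)
    · exact isClosed_eq (by fun_prop) (by fun_prop)
    · exact isClosed_eq (by fun_prop) (by fun_prop)
  · refine fun β hβ => ⟨fun q m => (hβ q).1 m, fun q m => ?_⟩
    by_cases hm : m ∈ D.moves q
    · exact (Finset.single_le_sum (fun m _ => (hβ q).1 m) hm).trans_eq (hβ q).2.2
    · rw [(hβ q).2.1 m hm]
      exact zero_le_one

theorem convex_setOf_isLocal {Q L M : Type*} (D : PreMDP Q L M) :
    Convex ℝ {β : Q → M → ℝ | IsLocal D β} := by
  intro β hβ γ hγ s t hs ht hst q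
  refine ⟨fun m => ?_, fun m hm => ?_, ?_⟩
  · exact add_nonneg (mul_nonneg hs ((hβ q).1 m)) (mul_nonneg ht ((hγ q).1 m))
  · simp [(hβ q).2.1 m hm, (hγ q).2.1 m hm]
  · simp [Finset.sum_add_distrib, ← Finset.mul_sum, (hβ q).2.2, (hγ q).2.2, hst]

theorem exists_forall_dotProduct_ne_zero {ι κ : Type*} [Fintype ι] [Finite κ] (d : κ → ι → ℝ) :
    ∃ w : ι → ℝ, ∀ i, d i ≠ 0 → d i ⬝ᵥ w ≠ 0 := by
  obtain ⟨w, hw⟩ := Module.Dual.exists_forall_ne_zero_of_forall_exists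
    (fun i : {i // d i ≠ 0} => dotProductBilin ℝ ℝ (d i)) (fun i => ⟨d i, by
      simpa using i.2⟩)
  exact ⟨w, fun i hi => hw ⟨i, hi⟩⟩

open Filter Topology in
/-- Every neighbourhood of `v`, seen through finitely many strict linear inequalities,
contains a vector outside finitely many given hyperplanes. -/
theorem exists_dotProduct_pos_and_ne_zero {ι κ κ' : Type*} [Fintype ι] [Finite κ] [Finite κ']
    (d : κ → ι → ℝ) (e : κ' → ι → ℝ) (v : ι → ℝ) (hv : ∀ j, 0 < e j ⬝ᵥ v) :
    ∃ w : ι → ℝ, (∀ j, 0 < e j ⬝ᵥ w) ∧ ∀ i, d i ≠ 0 → d i ⬝ᵥ w ≠ 0 := by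
  obtain ⟨w, hw⟩ := exists_forall_dotProduct_ne_zero d
  have hpos : ∀ᶠ ε : ℝ in 𝓝[≠] 0, ∀ j, 0 < e j ⬝ᵥ (v + ε • w) := by
    refine eventually_all.2 fun j => eventually_nhdsWithin_of_eventually_nhds ?_
    have hc : Continuous fun ε : ℝ => e j ⬝ᵥ (v + ε • w) := by
      simp only [dotProduct_add, dotProduct_smul]
      fun_prop
    exact hc.continuousAt.eventually_const_lt (by simpa using hv j)
  have hne : ∀ᶠ ε : ℝ in 𝓝[≠] 0, ∀ i, d i ≠ 0 → d i ⬝ᵥ (v + ε • w) ≠ 0 := by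
    refine eventually_all.2 fun i => ?_
    by_cases hi : d i = 0
    · simp [hi]
    have hev : ∀ᶠ ε : ℝ in 𝓝[≠] 0, ε ≠ -(d i ⬝ᵥ v) / (d i ⬝ᵥ w) := by
      rcases eq_or_ne (-(d i ⬝ᵥ v) / (d i ⬝ᵥ w)) 0 with h0 | h0
      · rw [h0]
        exact self_mem_nhdsWithin
      · exact eventually_nhdsWithin_of_eventually_nhds (eventually_ne_nhds h0.symm)
    filter_upwards [hev] with ε hε _ h0
    refine hε ?_
    rw [dotProduct_add, dotProduct_smul, smul_eq_mul] at h0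
    rw [eq_div_iff (hw i hi)]
    linarith
  obtain ⟨ε, h1, h2⟩ := (hpos.and hne).exists
  exact ⟨_, h1, h2⟩

theorem exists_point_eq {Q L M : Type*} {k : ℕ} [Fintype Q] [Fintype L] [Fintype M]
    [DecidableEq Q] {D : PreMDP Q L M} {B : Matrix Q (Fin k) ℝ}
    (hD : ∀ q, (D.moves q).Nonempty) {μ ν : Q → ℝ} (hμ : 0 ≤ μ)
    (hμν : ∀ α, IsLocal D α → Extremal D B α → point D B μ α = point D B ν α)
    {β : Q → M → ℝ} (hβ : IsLocal D β) :
    ∃ γ, IsLocal D γ ∧ point D B μ β = point D B ν γ := by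
  classical
  by_contra hcon
  have hnot : point D B μ β ∉ point D B ν '' {γ | IsLocal D γ} := by
    rintro ⟨γ, hγ, h⟩
    exact hcon ⟨γ, hγ, h.symm⟩
  have hcont : Continuous (point D B ν) :=
    (isLinearMap_point D B ν).mk'.continuous_of_finiteDimensional
  obtain ⟨f, c, hf, hc⟩ := geometric_hahn_banach_closed_point
    ((convex_setOf_isLocal D).is_linear_image (isLinearMap_point D B ν))
    ((isCompact_setOf_isLocal D).image hcont).isClosed hnot
  let v : L × Fin k → ℝ := fun i => f (Pi.single i 1)
  have hfv : ∀ x, f x = x ⬝ᵥ v := fun x => by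
    conv_lhs => rw [pi_eq_sum_univ' x, map_sum]
    simp only [map_smul, smul_eq_mul]
    rfl
  obtain ⟨w, hpos, hgen⟩ := exists_dotProduct_pos_and_ne_zero
    (fun i : M × M => moveVec D B i.1 - moveVec D B i.2)
    (fun g : {g : Q → M // ∀ q, g q ∈ D.moves q} =>
      point D B μ β - point D B ν (pureStrategy g)) v (fun g => by
        rw [← hfv, map_sub, sub_pos]
        exact (hf _ ⟨_, isLocal_pureStrategy g.2, rfl⟩).trans hc)
  obtain ⟨g, hg, hext⟩ := exists_extremalIn_pureStrategy (v := w) hD fun m m' h => by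
    by_contra hne
    exact hgen (m, m') (sub_ne_zero.2 hne) (by rw [sub_dotProduct, h, sub_self])
  have h1 := hpos ⟨g, hg⟩
  rw [sub_dotProduct, ← hμν _ (isLocal_pureStrategy hg) ⟨w, hext⟩, sub_pos] at h1
  exact h1.not_ge (hext.dotProduct_le hμ hβ)

section Vseq

variable {Q L M : Type*} [Fintype Q] [Fintype L] [Fintype M] [DecidableEq Q] {D : PreMDP Q L M}

theorem Vseq_le_succ (n : ℕ) : Vseq D n ≤ Vseq D (n + 1) := le_sup_left

theorem mulVec_mem_Vseq_succ {n : ℕ} {u : Q → ℝ} (hu : u ∈ Vseq D n) (a : L)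
    {α : Q → M → ℝ} (hα : IsLocal D α) (hext : ExtremalSpace D (Vseq D n) α) :
    transMat D α a *ᵥ u ∈ Vseq D (n + 1) :=
  Submodule.mem_sup_right (Submodule.subset_span ⟨u, hu, a, α, hα, hext, rfl⟩)

theorem one_mem_Vseq (n : ℕ) : (fun _ => (1 : ℝ)) ∈ Vseq D n := by
  induction n with
  | zero => exact Submodule.mem_span_singleton_self _
  | succ n ih => exact Vseq_le_succ n ih

theorem succ_le_finrank_Vseq [Nonempty Q] {s : ℕ}
    (h : ∀ t < s, Vseq D t ≠ Vseq D (t + 1)) : s + 1 ≤ Module.finrank ℝ (Vseq D s) := by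
  induction s with
  | zero =>
    refine (finrank_span_singleton (K := ℝ) (v := fun _ : Q => (1 : ℝ)) fun h0 => ?_).ge
    exact one_ne_zero (congrFun h0 (Classical.arbitrary Q))
  | succ s ih =>
    exact (Nat.succ_le_succ (ih fun t ht => h t (ht.trans s.lt_succ_self))).trans
      (Submodule.finrank_lt_finrank_of_lt ((Vseq_le_succ s).lt_of_ne (h s s.lt_succ_self)))

theorem IsBisim.dotProduct_eq (hD : ∀ m a q, 0 ≤ D.prob m a q) {R : (Q → ℝ) → (Q → ℝ) → Prop}
    (hR : IsBisim D D R) (n : ℕ) {μ ν : Q → ℝ} (hμ : 0 ≤ μ) (hν : 0 ≤ ν) (h : R μ ν)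
    {u : Q → ℝ} (hu : u ∈ Vseq D n) : μ ⬝ᵥ u = ν ⬝ᵥ u := by
  induction n generalizing μ ν u with
  | zero =>
    obtain ⟨c, rfl⟩ := Submodule.mem_span_singleton.1 hu
    simp only [dotProduct_smul]
    congr 1
    simpa [dotProduct] using (hR μ ν h).1
  | succ n ih =>
    obtain ⟨x, hx, y, hy, rfl⟩ := Submodule.mem_sup.1 hu
    rw [dotProduct_add, dotProduct_add, ih hμ hν h hx]
    congr 1
    clear hu
    induction hy using Submodule.span_induction with
    | zero => simp
    | add x y _ _ hx hy => rw [dotProduct_add, dotProduct_add, hx, hy]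
    | smul c x _ hx => rw [dotProduct_smul, dotProduct_smul, hx]
    | mem y hy =>
      obtain ⟨u, hu, a, α, hα, ⟨k, B, hB, v, hv⟩, rfl⟩ := hy
      obtain ⟨-, hfwd, hbwd⟩ := hR μ ν h
      obtain ⟨β, hβ, hRβ⟩ := hfwd α hα
      obtain ⟨γ, hγ, hRγ⟩ := hbwd α hα
      have hpβ : point D B μ α = point D B ν β := (point_eq_point_iff D B).2 fun a u hu =>
        ih (Succ_nonneg hD hμ hα a) (Succ_nonneg hD hν hβ a) (hRβ a) (hB ▸ hu)
      have hpγ : point D B μ γ = point D B ν α := (point_eq_point_iff D B).2 fun a u hu =>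
        ih (Succ_nonneg hD hμ hγ a) (Succ_nonneg hD hν hα a) (hRγ a) (hB ▸ hu)
      have hle : point D B ν α ⬝ᵥ v ≤ point D B ν β ⬝ᵥ v := by
        rw [← hpγ, ← hpβ]
        exact hv.dotProduct_le hμ hγ
      have heq : point D B μ α = point D B ν α :=
        hpβ.trans (hv.point_eq hν hβ ((hv.dotProduct_le hν hβ).antisymm hle))
      rw [← Succ_dotProduct, ← Succ_dotProduct]
      exact (point_eq_point_iff D B).1 heq a u (hB ▸ hu)

theorem exists_forall_Succ_dotProduct_eq (hD : ∀ q, (D.moves q).Nonempty) {s : ℕ}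
    (hfix : Vseq D s = Vseq D (s + 1)) {μ ν : Q → ℝ} (hμ : 0 ≤ μ)
    (h : ∀ u ∈ Vseq D s, μ ⬝ᵥ u = ν ⬝ᵥ u) {β : Q → M → ℝ} (hβ : IsLocal D β) :
    ∃ γ, IsLocal D γ ∧ ∀ a, ∀ u ∈ Vseq D s, Succ D μ β a ⬝ᵥ u = Succ D ν γ a ⬝ᵥ u := by
  obtain ⟨k, B, hB⟩ := exists_colSpace_eq (Vseq D s)
  obtain ⟨γ, hγ, hp⟩ := exists_point_eq (B := B) hD hμ (ν := ν) (fun α hα hext => by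
    refine (point_eq_point_iff D B).2 fun a u hu => ?_
    rw [Succ_dotProduct, Succ_dotProduct]
    refine h _ ?_
    rw [hfix]
    exact mulVec_mem_Vseq_succ (hB ▸ hu) a hα ⟨k, B, hB, hext⟩) hβ
  exact ⟨γ, hγ, hB ▸ (point_eq_point_iff D B).1 hp⟩

theorem isBisim_of_Vseq_eq_succ (hD : IsMDP D) {s : ℕ} (hfix : Vseq D s = Vseq D (s + 1)) :
    IsBisim D D fun μ ν => 0 ≤ μ ∧ 0 ≤ ν ∧ ∀ u ∈ Vseq D s, μ ⬝ᵥ u = ν ⬝ᵥ u := by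
  obtain ⟨-, -, hne, hprob, -⟩ := hD
  rintro μ ν ⟨hμ, hν, h⟩
  refine ⟨by simpa [dotProduct] using h _ (one_mem_Vseq s), fun β hβ => ?_, fun γ hγ => ?_⟩
  · obtain ⟨γ, hγ, hS⟩ := exists_forall_Succ_dotProduct_eq hne hfix hμ h hβ
    exact ⟨γ, hγ, fun a => ⟨Succ_nonneg hprob hμ hβ a, Succ_nonneg hprob hν hγ a, hS a⟩⟩
  · obtain ⟨β, hβ, hS⟩ := exists_forall_Succ_dotProduct_eq hne hfix hν
      (fun u hu => (h u hu).symm) hγ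
    exact ⟨β, hβ, fun a => ⟨Succ_nonneg hprob hμ hβ a, Succ_nonneg hprob hν hγ a,
      fun u hu => (hS a u hu).symm⟩⟩

end Vseq

/-- The sequence `V_n` stabilizes at some `s ≤ |Q| − 1`, and bisimilarity
of subdistributions is characterized by agreement on the limit space `V = V_s`. -/
theorem stmt12 {Q L M : Type*} [Fintype Q] [Fintype L] [Fintype M] [DecidableEq Q]
    (D : PreMDP Q L M) (hD : IsMDP D) (s : ℕ)
    (hfix : Vseq D s = Vseq D (s + 1)) (hmin : ∀ t < s, Vseq D t ≠ Vseq D (t + 1)) :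
    s ≤ Fintype.card Q - 1 ∧
      ∀ μD μE : Q → ℝ, IsSubDist μD → IsSubDist μE →
        (Bisim D D μD μE ↔ ∀ u ∈ Vseq D s, μD ⬝ᵥ u = μE ⬝ᵥ u) := by
  have hQ : Nonempty Q := by
    by_contra hQ
    rw [not_nonempty_iff] at hQ
    simpa using hD.2.1
  refine ⟨?_, fun μD μE hμD hμE => ⟨fun ⟨R, hR, h⟩ u hu => ?_, fun h => ?_⟩⟩
  · have hle := (succ_le_finrank_Vseq hmin).trans (Submodule.finrank_le (Vseq D s))
    rw [Module.finrank_fintype_fun_eq_card] at hle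
    omega
  · exact hR.dotProduct_eq hD.2.2.2.1 s hμD.1 hμE.1 h hu
  · exact ⟨_, isBisim_of_Vseq_eq_succ hD hfix, hμD.1, hμE.1, h⟩
end

section
/- Let D = ⟨Q, μ0^D, L, δ⟩ be a labelled MDP and let C = ⟨Q_C, μ0^C, L, δ⟩ be a labelled MC with Q_C ⊆ Q (every state in Q_C has exactly one available move, and δ agrees on Q_C). Let n ≥ 0, k ≥ 1, and suppose B ∈ ℝ^{Q×k} is such that for all subdistributions μ_D over Q and μ_C over Q_C: μ_D ∼_n μ_C if and only if μ_D·B = μ_C·B. Then for all such μ_D, μ_C: μ_D ∼_{n+1} μ_C if and only if μ_D·B = μ_C·B and μ_D·Δ_α(a)·B = μ_C·Δ_α(a)·B holds for all a ∈ L and all local strategies α. -/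
open Matrix

/-- `μ` is supported in the set `S`. -/
def SuppIn {Q : Type*} (μ : Q → ℝ) (S : Finset Q) : Prop := ∀ q ∉ S, μ q = 0

theorem simN_sum_eq {Q L M : Type*} [Fintype Q] {D : PreMDP Q L M} {n : ℕ} {μ ν : Q → ℝ}
    (h : simN D n μ ν) : ∑ q, μ q = ∑ q, ν q := by
  cases n with
  | zero => exact h
  | succ n => exact h.1

/-- The approximants decrease with the index. -/
theorem simN_of_simN_succ {Q L M : Type*} [Fintype Q] {D : PreMDP Q L M} {n : ℕ} {μ ν : Q → ℝ}
    (h : simN D (n + 1) μ ν) : simN D n μ ν := by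
  induction n generalizing μ ν with
  | zero => exact h.1
  | succ n ih =>
    refine ⟨h.1, fun β hβ => ?_, fun γ hγ => ?_⟩
    · obtain ⟨γ, hγ, hs⟩ := h.2.1 β hβ
      exact ⟨γ, hγ, fun a => ih (hs a)⟩
    · obtain ⟨β, hβ, hs⟩ := h.2.2 γ hγ
      exact ⟨β, hβ, fun a => ih (hs a)⟩

theorem IsLocal.transMat_nonneg {Q L M : Type*} [Fintype Q] [Fintype L] {D : PreMDP Q L M}
    (hD : IsMDP D) {β : Q → M → ℝ} (hβ : IsLocal D β) (a : L) (q q' : Q) :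
    0 ≤ transMat D β a q q' :=
  Finset.sum_nonneg fun m _ => mul_nonneg ((hβ q).1 m) (hD.2.2.2.1 m a q')

theorem IsLocal.sum_transMat_le_one {Q L M : Type*} [Fintype Q] [Fintype L] {D : PreMDP Q L M}
    (hD : IsMDP D) {β : Q → M → ℝ} (hβ : IsLocal D β) (a : L) (q : Q) :
    ∑ q', transMat D β a q q' ≤ 1 := by
  calc ∑ q', transMat D β a q q' = ∑ m ∈ D.moves q, β q m * ∑ q', D.prob m a q' := by
        simp only [transMat, Matrix.of_apply, Finset.mul_sum]
        exact Finset.sum_comm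
    _ ≤ ∑ m ∈ D.moves q, β q m := Finset.sum_le_sum fun m hm =>
        mul_le_of_le_one_right ((hβ q).1 m) <| hD.2.2.2.2 q m hm ▸
          Finset.single_le_sum (f := fun b => ∑ q', D.prob m b q')
            (fun b _ => Finset.sum_nonneg fun q' _ => hD.2.2.2.1 m b q') (Finset.mem_univ a)
    _ = 1 := (hβ q).2.2

theorem IsSubDist.succ {Q L M : Type*} [Fintype Q] [Fintype L] {D : PreMDP Q L M}
    (hD : IsMDP D) {β : Q → M → ℝ} (hβ : IsLocal D β) {μ : Q → ℝ} (hμ : IsSubDist μ) (a : L) :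
    IsSubDist (Succ D μ β a) := by
  refine ⟨fun q' => Finset.sum_nonneg fun q _ =>
    mul_nonneg (hμ.1 q) (hβ.transMat_nonneg hD a q q'), ?_⟩
  calc ∑ q', Succ D μ β a q' = ∑ q, μ q * ∑ q', transMat D β a q q' := by
        simp only [Succ, Matrix.vecMul, dotProduct, Finset.mul_sum]
        exact Finset.sum_comm
    _ ≤ ∑ q, μ q := Finset.sum_le_sum fun q _ =>
        mul_le_of_le_one_right (hμ.1 q) (hβ.sum_transMat_le_one hD a q)
    _ ≤ 1 := hμ.2

/-- A closed set of states supports the successors of what it supports. -/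
theorem SuppIn.succ {Q L M : Type*} [Fintype Q] {D : PreMDP Q L M} {S : Finset Q}
    (hclosed : ∀ q ∈ S, ∀ m ∈ D.moves q, ∀ (a : L) (q' : Q), D.prob m a q' ≠ 0 → q' ∈ S)
    {μ : Q → ℝ} (hμ : SuppIn μ S) (β : Q → M → ℝ) (a : L) : SuppIn (Succ D μ β a) S := by
  intro q' hq'
  refine Finset.sum_eq_zero fun q _ => ?_
  by_cases hq : q ∈ S
  · refine mul_eq_zero_of_right _ (Finset.sum_eq_zero fun m hm => mul_eq_zero_of_right _ ?_)
    by_contra h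
    exact hq' (hclosed q hq m hm a q' h)
  · exact mul_eq_zero_of_left (hμ q hq) _

/-- On states with a unique move, successors do not depend on the local strategy. -/
theorem SuppIn.succ_eq_succ {Q L M : Type*} [Fintype Q] {D : PreMDP Q L M} {S : Finset Q}
    (hone : ∀ q ∈ S, (D.moves q).card = 1) {μ : Q → ℝ} (hμ : SuppIn μ S) {β γ : Q → M → ℝ}
    (hβ : IsLocal D β) (hγ : IsLocal D γ) (a : L) : Succ D μ β a = Succ D μ γ a := by
  ext q'
  refine Finset.sum_congr rfl fun q _ => ?_
  by_cases hq : q ∈ S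
  · obtain ⟨m, hm⟩ := Finset.card_eq_one.mp (hone q hq)
    have h1 := (hβ q).2.2
    have h2 := (hγ q).2.2
    simp only [hm, Finset.sum_singleton] at h1 h2
    simp [transMat, hm, h1, h2]
  · simp [hμ q hq]

/-- If the second system is an MC (a sub-structure of `D` on a closed
set `QC` of states with a unique move each) and `B` characterizes `∼ₙ`, then `∼ₙ₊₁` is
characterized by agreement under `B` and under `Δ_α(a)·B` for all labels `a` and all
local strategies `α`. -/
theorem stmt13 {Q L M : Type*} {k : ℕ} [Fintype Q] [Fintype L] [Fintype M] [DecidableEq Q]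
    (D : PreMDP Q L M) (hD : IsMDP D) (QC : Finset Q)
    (hone : ∀ q ∈ QC, (D.moves q).card = 1)
    (hclosed : ∀ q ∈ QC, ∀ m ∈ D.moves q, ∀ (a : L) (q' : Q), D.prob m a q' ≠ 0 → q' ∈ QC)
    (n : ℕ) (hk : 1 ≤ k) (B : Matrix Q (Fin k) ℝ)
    (hB : ∀ μD μC : Q → ℝ, IsSubDist μD → IsSubDist μC → SuppIn μC QC →
      (simN D n μD μC ↔ Matrix.vecMul μD B = Matrix.vecMul μC B)) :
    ∀ μD μC : Q → ℝ, IsSubDist μD → IsSubDist μC → SuppIn μC QC →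
      (simN D (n + 1) μD μC ↔
        (Matrix.vecMul μD B = Matrix.vecMul μC B ∧
          ∀ (a : L) (β : Q → M → ℝ), IsLocal D β →
            Matrix.vecMul (Matrix.vecMul μD (transMat D β a)) B =
              Matrix.vecMul (Matrix.vecMul μC (transMat D β a)) B)) := by
  intro μD μC hμD hμC hS
  have key : ∀ β γ, IsLocal D β → IsLocal D γ → ∀ a,
      (simN D n (Succ D μD β a) (Succ D μC γ a) ↔
        Matrix.vecMul (Matrix.vecMul μD (transMat D β a)) B =
          Matrix.vecMul (Matrix.vecMul μC (transMat D β a)) B) := by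
    intro β γ hβ hγ a
    rw [hS.succ_eq_succ hone hγ hβ a]
    exact hB _ _ (hμD.succ hD hβ a) (hμC.succ hD hβ a) (hS.succ hclosed β a)
  constructor
  · intro h
    refine ⟨(hB _ _ hμD hμC hS).mp (simN_of_simN_succ h), fun a β hβ => ?_⟩
    obtain ⟨γ, hγ, hs⟩ := h.2.1 β hβ
    exact (key β γ hβ hγ a).mp (hs a)
  · rintro ⟨h, hs⟩
    exact ⟨simN_sum_eq ((hB _ _ hμD hμC hS).mpr h),
      fun β hβ => ⟨β, hβ, fun a => (key β β hβ hβ a).mpr (hs a β hβ)⟩,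
      fun γ hγ => ⟨γ, hγ, fun a => (key γ γ hγ hγ a).mpr (hs a γ hγ)⟩⟩
end
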